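/- arXiv:1810.08240 — 2 statements merged into one kernel-verified Lean document; each statement's English description precedes it below -/
import Mathlib

section
/- Stitched boundary theorem (decay of late crossings): For any c ≥ 0, α ∈ (0,1), η > 1, m > 0, l0 ≥ 1, any increasing function h : ℝ≥0 → ℝ>0 with Σ_{k=0}^∞ 1/h(k) ≤ 1, any l0-sub-ψ_{G,c} process (S_t) with variance process (V_t), and any v0 ≥ m, P(∃ t ≥ 1 : V_t ≥ v0 and S_t ≥ S_α(V_t)) ≤ Σ_{k=⌊log_η(v0/m)⌋}^∞ 1/h(k). -/
open MeasureTheory ProbabilityTheory Filter Set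

noncomputable section

/-- `S` is an `l0`-sub-ψ process with variance process `V`, where ψ has domain `D`. -/
def IsSubPsi {Ω : Type*} {mΩ : MeasurableSpace Ω} (P : Measure Ω)
    (F : Filtration ℕ mΩ) (D : Set ℝ) (ψ : ℝ → ℝ) (l0 : ℝ)
    (S V : ℕ → Ω → ℝ) : Prop :=
  Adapted F S ∧ Adapted F V ∧
    (∀ ω, S 0 ω = 0) ∧ (∀ ω, V 0 ω = 0) ∧ (∀ t ω, 0 ≤ V t ω) ∧
    ∀ l ∈ D, ∃ L : ℕ → Ω → ℝ,
      Supermartingale L F P ∧ (∀ t ω, 0 ≤ L t ω) ∧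
      (∫ ω, L 0 ω ∂P) ≤ l0 ∧
      ∀ t : ℕ, ∀ᵐ ω ∂P, Real.exp (l * S t ω - ψ l * V t ω) ≤ L t ω

/-- ψ_{G,c}, the sub-gamma `ψ` function. -/
def psiG (c l : ℝ) : ℝ := l ^ 2 / (2 * (1 - c * l))

/-- Domain `[0, 1/(c ⊔ 0))` of ψ_{G,c} (with `1/0 = ∞`). -/
def psiGDom (c : ℝ) : Set ℝ := {l : ℝ | 0 ≤ l ∧ (0 < c → l < 1 / c)}

/-- ℓ(v) = log h(log_η(v/m)) + log(l0/α). -/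
def stitchEll (h : ℝ → ℝ) (η m l0 α v : ℝ) : ℝ :=
  Real.log (h (Real.logb η (v / m))) + Real.log (l0 / α)

def stitchK1 (η : ℝ) : ℝ := (η ^ ((1 : ℝ) / 4) + η ^ (-(1 : ℝ) / 4)) / Real.sqrt 2

def stitchK2 (η : ℝ) : ℝ := (Real.sqrt η + 1) / 2

/-- The stitching function 𝒮_α(v). -/
def stitchFn (h : ℝ → ℝ) (η m l0 α c v : ℝ) : ℝ :=
  Real.sqrt (stitchK1 η ^ 2 * v * stitchEll h η m l0 α v
      + stitchK2 η ^ 2 * c ^ 2 * stitchEll h η m l0 α v ^ 2)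
    + c * stitchK2 η * stitchEll h η m l0 α v

/-- Finite-horizon **Ville inequality** for nonnegative supermartingales. -/
theorem supermartingale_exists_le_ge {Ω : Type*} {mΩ : MeasurableSpace Ω} {P : Measure Ω}
    [IsFiniteMeasure P] {F : Filtration ℕ mΩ} {L : ℕ → Ω → ℝ} (hL : Supermartingale L F P)
    (hnonneg : ∀ t ω, 0 ≤ L t ω) {C : ℝ} (hC : 0 < C) (n : ℕ) :
    P {ω | ∃ t ≤ n, C ≤ L t ω} ≤ ENNReal.ofReal ((∫ ω, L 0 ω ∂P) / C) := by
  let τ : Ω → WithTop ℕ := fun ω => ((hittingBtwn L (Set.Ici C) 0 n ω : ℕ) : WithTop ℕ)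
  have hτ : IsStoppingTime F τ :=
    hL.stronglyAdapted.adapted.isStoppingTime_hittingBtwn measurableSet_Ici
  have hτn : ∀ ω, τ ω ≤ (n : WithTop ℕ) := fun ω => WithTop.coe_le_coe.2 (hittingBtwn_le ω)
  have hint : Integrable (stoppedValue L τ) P := by
    have := (hL.neg.integrable_stoppedValue hτ hτn).neg
    refine this.congr (Eventually.of_forall fun ω => ?_)
    simp [stoppedValue]
  have hle : ∫ ω, stoppedValue L τ ω ∂P ≤ ∫ ω, L 0 ω ∂P := by
    have := hL.neg.expected_stoppedValue_mono (isStoppingTime_const F 0) hτ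
      (fun ω => WithTop.coe_le_coe.2 (Nat.zero_le _)) hτn
    have hneg : ∫ ω, -L 0 ω ∂P ≤ ∫ ω, -stoppedValue L τ ω ∂P := this
    rwa [integral_neg, integral_neg, neg_le_neg_iff] at hneg
  have hsub : {ω | ∃ t ≤ n, C ≤ L t ω} ⊆ {ω | C ≤ stoppedValue L τ ω} := by
    rintro ω ⟨t, ht, hCt⟩
    exact stoppedValue_hittingBtwn_mem (s := Set.Ici C) ⟨t, ⟨Nat.zero_le _, ht⟩, hCt⟩
  have hmarkov := mul_meas_ge_le_integral_of_nonneg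
    (Eventually.of_forall fun ω => hnonneg _ ω : 0 ≤ᵐ[P] stoppedValue L τ) hint C
  refine (measure_mono hsub).trans ?_
  rw [← ENNReal.ofReal_toReal (measure_ne_top P _)]
  refine ENNReal.ofReal_le_ofReal ?_
  rw [le_div_iff₀ hC, mul_comm]
  exact hmarkov.trans hle

/-- **Ville's inequality** for nonnegative supermartingales. -/
theorem supermartingale_exists_ge {Ω : Type*} {mΩ : MeasurableSpace Ω} {P : Measure Ω}
    [IsFiniteMeasure P] {F : Filtration ℕ mΩ} {L : ℕ → Ω → ℝ} (hL : Supermartingale L F P)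
    (hnonneg : ∀ t ω, 0 ≤ L t ω) {C : ℝ} (hC : 0 < C) :
    P {ω | ∃ t, C ≤ L t ω} ≤ ENNReal.ofReal ((∫ ω, L 0 ω ∂P) / C) := by
  have hUnion : {ω | ∃ t, C ≤ L t ω} = ⋃ n : ℕ, {ω | ∃ t ≤ n, C ≤ L t ω} := by
    ext ω
    simp only [Set.mem_ofPred_eq, Set.mem_iUnion]
    exact ⟨fun ⟨t, ht⟩ => ⟨t, t, le_rfl, ht⟩, fun ⟨_, t, _, ht⟩ => ⟨t, ht⟩⟩
  have hmono : Monotone fun n : ℕ => {ω | ∃ t ≤ n, C ≤ L t ω} :=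
    fun a b hab ω ⟨t, ht, h⟩ => ⟨t, ht.trans hab, h⟩
  rw [hUnion, hmono.measure_iUnion]
  exact iSup_le fun n => supermartingale_exists_le_ge hL hnonneg hC n

/-- A sub-ψ process crosses the line `l * S - ψ l * V = x` with probability at most
`l0 * exp (-x)`. -/
theorem IsSubPsi.measure_line_crossing {Ω : Type*} {mΩ : MeasurableSpace Ω} {P : Measure Ω}
    [IsFiniteMeasure P] {F : Filtration ℕ mΩ} {D : Set ℝ} {ψ : ℝ → ℝ} {l0 : ℝ}
    {S V : ℕ → Ω → ℝ} (hSV : IsSubPsi P F D ψ l0 S V) {l : ℝ} (hl : l ∈ D) (x : ℝ) :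
    P {ω | ∃ t, x ≤ l * S t ω - ψ l * V t ω} ≤ ENNReal.ofReal (l0 * Real.exp (-x)) := by
  obtain ⟨-, -, -, -, -, hexp⟩ := hSV
  obtain ⟨L, hL, hL0, hLint, hLle⟩ := hexp l hl
  have hae : ∀ᵐ ω ∂P, ∀ t, Real.exp (l * S t ω - ψ l * V t ω) ≤ L t ω := ae_all_iff.2 hLle
  calc P {ω | ∃ t, x ≤ l * S t ω - ψ l * V t ω}
      ≤ P {ω | ∃ t, Real.exp x ≤ L t ω} := by
        refine measure_mono_ae ?_
        filter_upwards [hae] with ω hω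
        rintro ⟨t, ht⟩
        exact ⟨t, (Real.exp_le_exp.2 ht).trans (hω t)⟩
    _ ≤ ENNReal.ofReal ((∫ ω, L 0 ω ∂P) / Real.exp x) :=
        supermartingale_exists_ge hL hL0 (Real.exp_pos x)
    _ ≤ _ := by
        refine ENNReal.ofReal_le_ofReal ?_
        rw [Real.exp_neg, ← div_eq_mul_inv]
        gcongr

/-- For every level `e > 0` and variance `u > 0` some `l` in the domain of `psiG c` satisfies
`psiG c l * u = e`; its inverse has a closed form. -/
theorem exists_mem_psiGDom_psiG_mul_eq {c e u : ℝ} (hc : 0 ≤ c) (he : 0 < e) (hu : 0 < u) :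
    ∃ l ∈ psiGDom c, 0 < l ∧ psiG c l * u = e ∧
      e / l = (c * e + Real.sqrt (2 * u * e + c ^ 2 * e ^ 2)) / 2 := by
  set s := Real.sqrt (2 * u * e + c ^ 2 * e ^ 2)
  have hs2 : s ^ 2 = 2 * u * e + c ^ 2 * e ^ 2 := Real.sq_sqrt (by positivity)
  have hue : 0 < u * e := by positivity
  have hs0 : 0 ≤ s := Real.sqrt_nonneg _
  have hce : 0 ≤ c * e := by positivity
  have hlt : c * e < s := by nlinarith
  have hpos : 0 < c * e + s := by linarith
  refine ⟨2 * e / (c * e + s), ⟨by positivity, fun hc' => ?_⟩, by positivity, ?_, ?_⟩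
  · rw [div_lt_div_iff₀ hpos hc']
    linarith
  · have h1 : 1 - c * (2 * e / (c * e + s)) = (s - c * e) / (c * e + s) := by
      field_simp
      ring
    have h2 : s - c * e ≠ 0 := (sub_pos.2 hlt).ne'
    have h3 : (c * e + s) * (s - c * e) = 2 * u * e := by linear_combination hs2
    calc psiG c (2 * e / (c * e + s)) * u
        = 2 * u * e ^ 2 / ((c * e + s) * (s - c * e)) := by
          rw [psiG, h1]
          field_simp
      _ = e := by
          rw [h3]
          field_simp
  · field_simp

theorem stitchK1_sq {η : ℝ} (hη : 0 < η) :
    stitchK1 η ^ 2 = (Real.sqrt η + 2 + 1 / Real.sqrt η) / 2 := by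
  have h1 : (η ^ ((1 : ℝ) / 4)) ^ 2 = Real.sqrt η := by
    rw [Real.sqrt_eq_rpow, ← Real.rpow_natCast, ← Real.rpow_mul hη.le]
    norm_num
  have h2 : η ^ (-(1 : ℝ) / 4) = 1 / η ^ ((1 : ℝ) / 4) := by
    rw [neg_div, Real.rpow_neg hη.le, one_div (η ^ _)]
  have h3 : 0 < η ^ ((1 : ℝ) / 4) := Real.rpow_pos_of_pos hη _
  rw [stitchK1, div_pow, Real.sq_sqrt zero_le_two, h2, ← h1]
  field_simp
  ring

/-- On the variance epoch `[a, a * η]`, the stitched boundary at level `e` lies above the line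
tuned to be optimal at `a * √η`. -/
theorem exists_line_le_stitched {c e a η : ℝ} (hc : 0 ≤ c) (he : 0 < e) (ha : 0 < a)
    (hη : 1 < η) :
    ∃ l ∈ psiGDom c, ∀ v s : ℝ, a ≤ v → v ≤ a * η →
      Real.sqrt (stitchK1 η ^ 2 * v * e + stitchK2 η ^ 2 * c ^ 2 * e ^ 2)
        + c * stitchK2 η * e ≤ s → e ≤ l * s - psiG c l * v := by
  set w := Real.sqrt η with hw
  have hw2 : w ^ 2 = η := Real.sq_sqrt (by linarith)
  have hw1 : 1 < w := by rw [hw]; exact Real.lt_sqrt_of_sq_lt (by linarith)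
  have hu : 0 < a * w := by positivity
  obtain ⟨l, hl, hl0, hψ, hel⟩ := exists_mem_psiGDom_psiG_mul_eq hc he hu
  refine ⟨l, hl, fun v s hav hva hs => ?_⟩
  have hv : 0 < v := by linarith
  obtain ⟨r, hr⟩ : ∃ r, r = v / (a * w) := ⟨_, rfl⟩
  have hvr : v = r * (a * w) := by rw [hr]; field_simp
  have hr0 : 0 < r := by rw [hr]; positivity
  have hrw : r ≤ w := by
    rw [hr, div_le_iff₀ hu, mul_comm w, mul_assoc, ← sq, hw2]
    exact hva
  have hwr : 1 ≤ r * w := by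
    have : a * 1 ≤ a * (r * w) := by rw [hvr] at hav; linarith
    exact le_of_mul_le_mul_left this ha
  have hk2 : (1 + r) / 2 ≤ stitchK2 η := by rw [stitchK2, ← hw]; linarith
  have hk1 : (1 + r) ^ 2 / 2 ≤ stitchK1 η ^ 2 * r := by
    rw [stitchK1_sq (by linarith), ← hw]
    have h1 : r ^ 2 + 1 ≤ (w + 1 / w) * r := by
      have h2 : (w + 1 / w) * r - (r ^ 2 + 1) = (w - r) * (r * w - 1) / w := by
        field_simp
        ring
      have h3 : 0 ≤ (w - r) * (r * w - 1) / w :=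
        div_nonneg (mul_nonneg (by linarith) (by linarith)) (by linarith)
      linarith
    nlinarith
  have hsqrt : (1 + r) / 2 * Real.sqrt (2 * (a * w) * e + c ^ 2 * e ^ 2)
      ≤ Real.sqrt (stitchK1 η ^ 2 * v * e + stitchK2 η ^ 2 * c ^ 2 * e ^ 2) := by
    refine Real.le_sqrt_of_sq_le ?_
    rw [mul_pow, Real.sq_sqrt (by positivity), hvr]
    have h1 : (1 + r) ^ 2 / 2 * (a * w * e) ≤ stitchK1 η ^ 2 * r * (a * w * e) := by gcongr
    have h2 : ((1 + r) / 2) ^ 2 * (c ^ 2 * e ^ 2) ≤ stitchK2 η ^ 2 * (c ^ 2 * e ^ 2) := by gcongr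
    linarith
  have hlin : (1 + r) / 2 * (c * e) ≤ stitchK2 η * (c * e) := by gcongr
  have hkey : (1 + r) * (e / l) ≤ s := by rw [hel]; linarith
  have hmul : (1 + r) * e ≤ l * s := by
    calc (1 + r) * e = l * ((1 + r) * (e / l)) := by field_simp
      _ ≤ l * s := by gcongr
  have hψv : psiG c l * v = r * e := by rw [hvr, ← hψ]; ring
  linarith

/-- A function value is at least one when the reciprocals sum to at most one. -/
theorem one_le_of_tsum_one_div_le_one {f : ℕ → ℝ} (hpos : ∀ k, 0 < f k)
    (hf : Summable fun k => 1 / f k) (hsum : ∑' k, 1 / f k ≤ 1) (k : ℕ) : 1 ≤ f k := by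
  have h1 : 1 / f k ≤ 1 := (hf.le_tsum k fun j _ => (one_div_pos.2 (hpos j)).le).trans hsum
  rwa [div_le_one (hpos k)] at h1

/-- Theorem 1 (stitched boundary, decay of late crossings): for any `l0`-sub-ψ_{G,c}
process `(S_t)` with variance process `(V_t)` and any `v0 ≥ m`,
`P(∃ t ≥ 1 : V_t ≥ v0 and S_t ≥ 𝒮_α(V_t)) ≤ Σ_{k=⌊log_η(v0/m)⌋}^∞ 1/h(k)`. -/
theorem stitched_boundary_late_crossing
    {Ω : Type*} {mΩ : MeasurableSpace Ω} (P : Measure Ω) [IsProbabilityMeasure P]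
    (F : Filtration ℕ mΩ)
    (c α η m l0 : ℝ) (hc : 0 ≤ c) (hα : α ∈ Set.Ioo (0 : ℝ) 1) (hη : 1 < η)
    (hm : 0 < m) (hl0 : 1 ≤ l0)
    (h : ℝ → ℝ) (hpos : ∀ x : ℝ, 0 ≤ x → 0 < h x)
    (hmono : MonotoneOn h (Set.Ici 0))
    (hsummable : Summable fun k : ℕ => 1 / h k)
    (hsum : (∑' k : ℕ, 1 / h k) ≤ 1)
    (S V : ℕ → Ω → ℝ)
    (hSV : IsSubPsi P F (psiGDom c) (psiG c) l0 S V)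
    (v0 : ℝ) (hv0 : m ≤ v0) :
    P {ω | ∃ t : ℕ, 1 ≤ t ∧ v0 ≤ V t ω ∧ stitchFn h η m l0 α c (V t ω) ≤ S t ω}
      ≤ ENNReal.ofReal (∑' k : ℕ, 1 / h ((⌊Real.logb η (v0 / m)⌋₊ + k : ℕ) : ℝ)) := by
  obtain ⟨hα0, hα1⟩ := hα
  have hl0' : 0 < l0 := by linarith
  have hη0 : 0 < η := by linarith
  have hpos' : ∀ k : ℕ, 0 < h k := fun k => hpos k k.cast_nonneg
  have hge : ∀ k : ℕ, 1 ≤ h k := one_le_of_tsum_one_div_le_one hpos' hsummable hsum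
  have hlα : 0 < Real.log (l0 / α) := Real.log_pos (by rw [lt_div_iff₀ hα0]; linarith)
  have he : ∀ k : ℕ, 0 < Real.log (h k) + Real.log (l0 / α) := fun k => by
    have := Real.log_nonneg (hge k)
    linarith
  choose l hl hline using fun k : ℕ =>
    exists_line_le_stitched hc (he k) (mul_pos hm (pow_pos hη0 k)) hη
  set K := ⌊Real.logb η (v0 / m)⌋₊
  have hcover : {ω | ∃ t : ℕ, 1 ≤ t ∧ v0 ≤ V t ω ∧ stitchFn h η m l0 α c (V t ω) ≤ S t ω} ⊆
      ⋃ k : ℕ, {ω | ∃ t, Real.log (h (K + k : ℕ)) + Real.log (l0 / α)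
        ≤ l (K + k) * S t ω - psiG c (l (K + k)) * V t ω} := by
    rintro ω ⟨t, -, hvt, hst⟩
    set v := V t ω
    have hv0pos : 0 < v0 / m := div_pos (by linarith) hm
    have hv0v : v0 / m ≤ v / m := by gcongr
    have hvpos : 0 < v / m := hv0pos.trans_le hv0v
    have hx0 : 0 ≤ Real.logb η (v / m) :=
      Real.logb_nonneg hη (by rw [le_div_iff₀ hm]; linarith)
    set j := ⌊Real.logb η (v / m)⌋₊
    have hjx : (j : ℝ) ≤ Real.logb η (v / m) := Nat.floor_le hx0
    have hxj : Real.logb η (v / m) < j + 1 := Nat.lt_floor_add_one _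
    have hKj : K ≤ j := Nat.floor_le_floor (Real.logb_le_logb_of_le hη hv0pos hv0v)
    have hlo : m * η ^ j ≤ v := by
      have := (Real.le_logb_iff_rpow_le hη hvpos).1 hjx
      rw [Real.rpow_natCast, le_div_iff₀ hm] at this
      linarith
    have hhi : v ≤ m * η ^ j * η := by
      have := (Real.logb_lt_iff_lt_rpow hη hvpos).1 hxj
      rw [← Nat.cast_add_one, Real.rpow_natCast, div_lt_iff₀ hm, pow_succ] at this
      linarith
    have hell : Real.log (h j) + Real.log (l0 / α) ≤ stitchEll h η m l0 α v := by
      rw [stitchEll]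
      gcongr
      · exact hpos' j
      · exact hmono (Set.mem_Ici.2 j.cast_nonneg) (Set.mem_Ici.2 hx0) hjx
    have hk2 : 0 ≤ stitchK2 η := by rw [stitchK2]; positivity
    have hv : 0 ≤ v := by nlinarith [pow_pos hη0 j]
    have hej := (he j).le
    refine Set.mem_iUnion.2 ⟨j - K, t, ?_⟩
    rw [Nat.add_sub_cancel' hKj]
    refine hline j v (S t ω) hlo hhi (le_trans ?_ hst)
    rw [stitchFn]
    gcongr
  have hbound : ∀ k : ℕ, P {ω | ∃ t, Real.log (h k) + Real.log (l0 / α)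
      ≤ l k * S t ω - psiG c (l k) * V t ω} ≤ ENNReal.ofReal (1 / h k) := fun k => by
    refine (hSV.measure_line_crossing (hl k) _).trans (ENNReal.ofReal_le_ofReal ?_)
    rw [Real.exp_neg, Real.exp_add, Real.exp_log (hpos' k), Real.exp_log (by positivity)]
    have := hpos' k
    calc l0 * (h k * (l0 / α))⁻¹ = α / h k := by field_simp
      _ ≤ 1 / h k := by gcongr
  have hsummable' : Summable fun k : ℕ => 1 / h ((K + k : ℕ) : ℝ) := by
    simpa only [add_comm] using (summable_nat_add_iff K).2 hsummable
  rw [ENNReal.ofReal_tsum_of_nonneg (fun k => (one_div_pos.2 (hpos' _)).le) hsummable']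
  exact (measure_mono hcover).trans
    ((measure_iUnion_le _).trans (ENNReal.tsum_le_tsum fun k => hbound (K + k)))
end
end

section
/- Empirical-Bernstein confidence sequence: Suppose X_t ∈ [a, b] a.s. for all t ≥ 1, let (X̂_t) be any [a, b]-valued predictable sequence, and let u be any 1-sub-ψ_{E,c} uniform boundary with crossing probability α for scale c = b − a. Define X̄_t := t^{−1} Σ_{i=1}^t X_i and μ_t := t^{−1} Σ_{i=1}^t E[X_i | F_{i−1}]. Then P( ∀ t ≥ 1 : |X̄_t − μ_t| < u( Σ_{i=1}^t (X_i − X̂_i)² ) / t ) ≥ 1 − 2α. -/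
open MeasureTheory ProbabilityTheory Filter Set

noncomputable section

/-- `u` is an `l0`-sub-ψ uniform boundary with crossing probability `α`. -/
def IsUniformBoundary (D : Set ℝ) (ψ : ℝ → ℝ) (l0 α : ℝ) (u : ℝ → ℝ) : Prop :=
  ∀ (Ω : Type) (mΩ : MeasurableSpace Ω) (P : Measure Ω),
    IsProbabilityMeasure P →
    ∀ (F : Filtration ℕ mΩ) (S V : ℕ → Ω → ℝ),
      IsSubPsi P F D ψ l0 S V →
      P {ω | ∃ t : ℕ, 1 ≤ t ∧ u (V t ω) ≤ S t ω} ≤ ENNReal.ofReal α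

/-- ψ_{E,c}(λ) = c⁻²(−log(1 − cλ) − cλ), the sub-exponential ψ function. -/
def psiE (c l : ℝ) : ℝ := (-Real.log (1 - c * l) - c * l) / c ^ 2

theorem exp_mul_sub_psiE_one_le {l x : ℝ} (hl0 : 0 ≤ l) (hl1 : l < 1) (hx : -1 ≤ x) :
    Real.exp (l * x - psiE 1 l * x ^ 2) ≤ 1 + l * x := by
  have hlx : -l ≤ l * x := by nlinarith
  have hpos : ∀ s ∈ Set.Icc (0 : ℝ) 1, 0 < 1 - l * s ∧ 1 - l * s ≤ 1 + l * x * s := by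
    intro s hs
    constructor <;> nlinarith [hs.1, hs.2]
  set f : ℝ → ℝ := fun s =>
    (-(l * s) - Real.log (1 - l * s)) * x ^ 2 - (l * x * s - Real.log (1 + l * x * s)) with hf
  have hderiv : ∀ s ∈ Set.Icc (0 : ℝ) 1, HasDerivAt f
      ((-l - -l / (1 - l * s)) * x ^ 2 - (l * x - l * x / (1 + l * x * s))) s := by
    intro s hs
    obtain ⟨h1, h2⟩ := hpos s hs
    have hid : ∀ k : ℝ, HasDerivAt (fun s : ℝ => k * s) k s := fun k => by
      simpa using (hasDerivAt_id s).const_mul k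
    exact ((((hid l).neg).sub (((hid l).const_sub 1).log h1.ne')).mul_const (x ^ 2)).sub
      ((hid (l * x)).sub (((hid (l * x)).const_add 1).log (h1.trans_le h2).ne'))
  have hmono : MonotoneOn f (Set.Icc 0 1) := by
    refine monotoneOn_of_deriv_nonneg (convex_Icc 0 1)
      (fun s hs => (hderiv s hs).continuousAt.continuousWithinAt)
      (fun s hs => (hderiv s (interior_subset hs)).differentiableAt.differentiableWithinAt) ?_
    intro s hs
    have hs' : s ∈ Set.Icc (0 : ℝ) 1 := interior_subset hs
    obtain ⟨h1, h2⟩ := hpos s hs'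
    have h3 := h1.trans_le h2
    rw [(hderiv s hs').deriv]
    have heq : (-l - -l / (1 - l * s)) * x ^ 2 - (l * x - l * x / (1 + l * x * s))
        = l ^ 2 * x ^ 2 * s * (1 / (1 - l * s) - 1 / (1 + l * x * s)) := by
      have e1 : -l - -l / (1 - l * s) = l ^ 2 * s * (1 / (1 - l * s)) := by
        field_simp [h1.ne']
        ring
      have e2 : l * x - l * x / (1 + l * x * s) = l ^ 2 * x ^ 2 * s * (1 / (1 + l * x * s)) := by
        rw [eq_comm, mul_one_div, eq_sub_iff_add_eq, ← add_div, div_eq_iff h3.ne']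
        ring
      rw [e1, e2]
      ring
    rw [heq]
    exact mul_nonneg (mul_nonneg (by positivity) hs'.1)
      (sub_nonneg.2 (one_div_le_one_div_of_le h1 h2))
  have hle := hmono (left_mem_Icc.2 zero_le_one) (right_mem_Icc.2 zero_le_one) zero_le_one
  have h3 : 0 < 1 + l * x := by linarith
  rw [← Real.le_log_iff_exp_le h3]
  simp only [hf, psiE] at hle ⊢
  norm_num at hle ⊢
  nlinarith

theorem exp_mul_sub_psiE_le {c l y : ℝ} (hc : 0 < c) (hl0 : 0 ≤ l) (hl1 : l < 1 / c)
    (hy : -c ≤ y) : Real.exp (l * y - psiE c l * y ^ 2) ≤ 1 + l * y := by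
  have h := exp_mul_sub_psiE_one_le (l := c * l) (x := y / c) (by positivity)
    (by rwa [lt_div_iff₀ hc, mul_comm] at hl1) (by rw [le_div_iff₀ hc]; linarith)
  have h1 : c * l * (y / c) = l * y := by field_simp
  have h2 : psiE 1 (c * l) * (y / c) ^ 2 = psiE c l * y ^ 2 := by
    simp only [psiE]
    field_simp
  rwa [h1, h2] at h

theorem psiE_nonneg {c l : ℝ} (hc : 0 < c) (hl1 : l < 1 / c) : 0 ≤ psiE c l := by
  have h : 0 < 1 - c * l := by
    rw [lt_div_iff₀ hc] at hl1
    linarith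
  have := Real.log_le_sub_one_of_pos h
  exact div_nonneg (by linarith) (by positivity)

/-- A uniform boundary controls processes on probability spaces in every universe, provided that
the exponential processes are themselves supermartingales. -/
theorem IsUniformBoundary.measure_exists_le {D : Set ℝ} {ψ : ℝ → ℝ} {α : ℝ} {u : ℝ → ℝ}
    (hu : IsUniformBoundary D ψ 1 α u)
    {Ω : Type*} {mΩ : MeasurableSpace Ω} {P : Measure Ω} [IsProbabilityMeasure P]
    {F : Filtration ℕ mΩ} {S V : ℕ → Ω → ℝ} (hS : Adapted F S) (hV : Adapted F V)
    (hS0 : ∀ ω, S 0 ω = 0) (hV0 : ∀ ω, V 0 ω = 0) (hVnonneg : ∀ t ω, 0 ≤ V t ω)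
    (hL : ∀ l ∈ D, Supermartingale (fun t ω => Real.exp (l * S t ω - ψ l * V t ω)) F P) :
    P {ω | ∃ t : ℕ, 1 ≤ t ∧ u (V t ω) ≤ S t ω} ≤ ENNReal.ofReal α := by
  let E := {x : ℕ → ℝ × ℝ // x 0 = 0 ∧ ∀ t, 0 ≤ (x t).2}
  let Z : ℕ → E → ℝ × ℝ := fun t x => x.1 t
  have hZ : ∀ t, Measurable (Z t) := fun t => (measurable_pi_apply t).comp measurable_subtype_coe
  let G : Filtration ℕ (inferInstance : MeasurableSpace E) :=
    Filtration.natural Z fun t => (hZ t).stronglyMeasurable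
  have hZG : ∀ t, Measurable[G t] (Z t) := fun t =>
    (Filtration.stronglyAdapted_natural fun t => (hZ t).stronglyMeasurable) t |>.measurable
  let φ : Ω → E := fun ω => ⟨fun t => (S t ω, V t ω),
    Prod.ext (hS0 ω) (hV0 ω), fun t => hVnonneg t ω⟩
  have hφ : Measurable φ := Measurable.subtype_mk
    (measurable_pi_lambda _ fun t => hS.measurable.prodMk hV.measurable)
  have hφG : ∀ t, Measurable[F t, G t] φ := by
    intro t
    refine measurable_iff_le_map.2 (iSup₂_le fun j hj => ?_)
    rw [← measurable_iff_le_map, measurable_comap_iff]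
    exact (hS.measurable_le hj).prodMk (hV.measurable_le hj)
  have hprob : IsProbabilityMeasure (P.map φ) := Measure.isProbabilityMeasure_map hφ.aemeasurable
  have hexp : ∀ l t, Measurable[G t] fun x : E =>
      Real.exp (l * (Z t x).1 - ψ l * (Z t x).2) := fun l t =>
    (((hZG t).fst.const_mul l).sub ((hZG t).snd.const_mul (ψ l))).exp
  have hexp' : ∀ l t, AEStronglyMeasurable (fun x : E =>
      Real.exp (l * (Z t x).1 - ψ l * (Z t x).2)) (P.map φ) := fun l t =>
    ((hexp l t).mono (G.le t) le_rfl).aestronglyMeasurable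
  have key := hu E inferInstance (P.map φ) hprob G (fun t x => (Z t x).1) (fun t x => (Z t x).2)
    ⟨fun t => (hZG t).fst, fun t => (hZG t).snd, fun x => congrArg Prod.fst x.2.1,
      fun x => congrArg Prod.snd x.2.1, fun t x => x.2.2 t, fun l hl =>
      ⟨fun t x => Real.exp (l * (Z t x).1 - ψ l * (Z t x).2), ?_, fun t x => (Real.exp_pos _).le,
        ?_, fun t => Eventually.of_forall fun x => le_rfl⟩⟩
  · exact (Measure.le_map_apply hφ.aemeasurable _).trans key
  · refine supermartingale_of_setIntegral_succ_le (fun t => (hexp l t).stronglyMeasurable)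
      (fun t => (integrable_map_measure (hexp' l t) hφ.aemeasurable).2 ((hL l hl).integrable t)) ?_
    intro t s hs
    rw [setIntegral_map (G.le t s hs) (hexp' l _) hφ.aemeasurable,
      setIntegral_map (G.le t s hs) (hexp' l _) hφ.aemeasurable]
    exact (hL l hl).setIntegral_le t.le_succ (hφG t hs)
  · have h0 : ∀ x : E, Real.exp (l * (Z 0 x).1 - ψ l * (Z 0 x).2) = 1 := fun x => by
      have : Z 0 x = 0 := x.2.1
      simp [this]
    simp [h0]

theorem condExp_exp_sub_psiE_le_one {Ω : Type*} {G mΩ : MeasurableSpace Ω} (hG : G ≤ mΩ)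
    {P : Measure Ω} [IsProbabilityMeasure P] {a b l : ℝ} (hab : a < b) (hl0 : 0 ≤ l)
    (hl1 : l < 1 / (b - a)) {X Y m : Ω → ℝ} (hXm : Measurable X) (hX : ∀ᵐ ω ∂P, X ω ∈ Icc a b)
    (hYm : StronglyMeasurable[G] Y) (hY : ∀ᵐ ω ∂P, Y ω ∈ Icc a b)
    (hmm : StronglyMeasurable[G] m) (hm : m =ᵐ[P] P[X|G]) :
    (∀ᵐ ω ∂P, Real.exp (l * (X ω - m ω) - psiE (b - a) l * (X ω - Y ω) ^ 2)
      ≤ Real.exp (l * (b - a))) ∧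
    P[fun ω => Real.exp (l * (X ω - m ω) - psiE (b - a) l * (X ω - Y ω) ^ 2)|G]
      ≤ᵐ[P] fun _ => 1 := by
  have hc : 0 < b - a := sub_pos.2 hab
  have hYm' := hYm.mono hG
  have hmm' := hmm.mono hG
  have hXint : Integrable X P := Integrable.of_mem_Icc a b hXm.aemeasurable hX
  have hYint : Integrable Y P := Integrable.of_mem_Icc a b hYm'.measurable.aemeasurable hY
  have hmbd : ∀ᵐ ω ∂P, m ω ∈ Icc a b := by
    have h1 := condExp_mono (m := G) (integrable_const a) hXint (hX.mono fun ω h => h.1)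
    have h2 := condExp_mono (m := G) hXint (integrable_const b) (hX.mono fun ω h => h.2)
    rw [condExp_const hG] at h1 h2
    filter_upwards [h1, h2, hm] with ω h1 h2 h3
    rw [h3]
    exact ⟨h1, h2⟩
  have hbd : ∀ᵐ ω ∂P, Real.exp (l * (X ω - m ω) - psiE (b - a) l * (X ω - Y ω) ^ 2)
      ≤ Real.exp (l * (b - a)) := by
    filter_upwards [hX, hmbd] with ω h1 h2
    refine Real.exp_le_exp.2 ?_
    have := mul_nonneg (psiE_nonneg hc hl1) (sq_nonneg (X ω - Y ω))
    have := mul_le_mul_of_nonneg_left (sub_le_sub h1.2 h2.1) hl0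
    linarith
  refine ⟨hbd, ?_⟩
  have hint : Integrable
      (fun ω => Real.exp (l * (X ω - m ω) - psiE (b - a) l * (X ω - Y ω) ^ 2)) P := by
    refine Integrable.of_bound ?_ (Real.exp (l * (b - a))) ?_
    · exact (((hXm.sub hmm'.measurable).const_mul l).sub
        (((hXm.sub hYm'.measurable).pow_const 2).const_mul _)).exp.aestronglyMeasurable
    · simpa [abs_of_pos (Real.exp_pos _)] using hbd
  set W : Ω → ℝ := fun ω => Real.exp (-(l * (m ω - Y ω))) with hW
  have hWm : StronglyMeasurable[G] W :=
    ((hmm.measurable.sub hYm.measurable).const_mul l).neg.exp.stronglyMeasurable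
  have hWbd : ∀ᵐ ω ∂P, ‖W ω‖ ≤ Real.exp (l * (b - a)) := by
    filter_upwards [hY, hmbd] with ω h1 h2
    rw [Real.norm_eq_abs, abs_of_pos (Real.exp_pos _)]
    refine Real.exp_le_exp.2 ?_
    have := mul_le_mul_of_nonneg_left (sub_le_sub h1.2 h2.1) hl0
    linarith
  set T : Ω → ℝ := (fun _ => 1) + l • (X - Y) with hT
  have hTint : Integrable T P := (integrable_const 1).add ((hXint.sub hYint).smul l)
  have hTcond : P[T|G] =ᵐ[P] fun ω => 1 + l * (m ω - Y ω) := by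
    have h1 := condExp_add (integrable_const (1 : ℝ)) ((hXint.sub hYint).smul l) G
    have h2 := condExp_smul (μ := P) l (X - Y) G
    have h3 := condExp_sub hXint hYint G
    rw [condExp_of_stronglyMeasurable hG hYm hYint] at h3
    rw [condExp_const hG] at h1
    filter_upwards [h1, h2, h3, hm] with ω h1 h2 h3 h4
    rw [hT, h1]
    simp [h2, h3, h4]
  have hWT : Integrable (W * T) P :=
    hTint.bdd_mul (hWm.mono hG).aestronglyMeasurable hWbd
  have hle : (fun ω => Real.exp (l * (X ω - m ω) - psiE (b - a) l * (X ω - Y ω) ^ 2))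
      ≤ᵐ[P] W * T := by
    filter_upwards [hX, hY] with ω h1 h2
    have h3 := exp_mul_sub_psiE_le hc hl0 hl1 (y := X ω - Y ω) (by linarith [h1.1, h2.2])
    have h4 : l * (X ω - m ω) - psiE (b - a) l * (X ω - Y ω) ^ 2 = -(l * (m ω - Y ω)) +
        (l * (X ω - Y ω) - psiE (b - a) l * (X ω - Y ω) ^ 2) := by ring
    rw [h4, Real.exp_add]
    exact mul_le_mul_of_nonneg_left h3 (Real.exp_pos _).le
  filter_upwards [condExp_mono (m := G) hint hWT hle, hTcond,
    condExp_stronglyMeasurable_mul_of_bound hG hWm hTint _ hWbd] with ω h1 h2 h3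
  refine h1.trans ?_
  rw [h3, Pi.mul_apply, h2, hW]
  calc Real.exp (-(l * (m ω - Y ω))) * (1 + l * (m ω - Y ω))
      ≤ Real.exp (-(l * (m ω - Y ω))) * Real.exp (l * (m ω - Y ω)) := by
        gcongr
        linarith [Real.add_one_le_exp (l * (m ω - Y ω))]
    _ = 1 := by rw [← Real.exp_add]; simp

/-- One-sided crossing bound for the centred sums; `m` is a version of the sequence of
conditional means. -/
theorem IsUniformBoundary.measure_exists_le_sum_sub_condExp
    {Ω : Type*} {mΩ : MeasurableSpace Ω} {P : Measure Ω} [IsProbabilityMeasure P]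
    {F : Filtration ℕ mΩ} {a b : ℝ} (hab : a < b) {X Xhat m : ℕ → Ω → ℝ}
    (hXadp : Adapted F X) (hXbd : ∀ t : ℕ, ∀ᵐ ω ∂P, X t ω ∈ Set.Icc a b)
    (hXhatbd : ∀ t : ℕ, ∀ᵐ ω ∂P, Xhat t ω ∈ Set.Icc a b)
    (hXhatpred : ∀ t : ℕ, StronglyMeasurable[F t] (Xhat (t + 1)))
    (hmpred : ∀ t : ℕ, StronglyMeasurable[F t] (m (t + 1)))
    (hm : ∀ t : ℕ, m (t + 1) =ᵐ[P] P[X (t + 1)|F t]) {α : ℝ} {u : ℝ → ℝ}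
    (hu : IsUniformBoundary {l : ℝ | 0 ≤ l ∧ l < 1 / (b - a)} (psiE (b - a)) 1 α u) :
    P {ω | ∃ t : ℕ, 1 ≤ t ∧ u (∑ i ∈ Finset.Icc 1 t, (X i ω - Xhat i ω) ^ 2)
      ≤ ∑ i ∈ Finset.Icc 1 t, (X i ω - m i ω)} ≤ ENNReal.ofReal α := by
  have hpred : ∀ {Y : ℕ → Ω → ℝ}, (∀ t, StronglyMeasurable[F t] (Y (t + 1))) →
      ∀ {t i : ℕ}, i ∈ Finset.Icc 1 t → Measurable[F t] (Y i) := by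
    intro Y hY t i hi
    obtain ⟨h1, h2⟩ := Finset.mem_Icc.1 hi
    obtain ⟨j, rfl⟩ := Nat.exists_eq_add_of_le' h1
    exact (hY j).measurable.mono (F.mono (by omega)) le_rfl
  have hS : Adapted F fun t ω => ∑ i ∈ Finset.Icc 1 t, (X i ω - m i ω) := fun t =>
    Finset.measurable_fun_sum _ fun i hi =>
      (hXadp.measurable_le (Finset.mem_Icc.1 hi).2).sub (hpred hmpred hi)
  have hV : Adapted F fun t ω => ∑ i ∈ Finset.Icc 1 t, (X i ω - Xhat i ω) ^ 2 := fun t =>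
    Finset.measurable_fun_sum _ fun i hi =>
      ((hXadp.measurable_le (Finset.mem_Icc.1 hi).2).sub (hpred hXhatpred hi)).pow_const 2
  refine hu.measure_exists_le hS hV (by simp) (by simp)
    (fun t ω => Finset.sum_nonneg fun i _ => sq_nonneg _) fun l ⟨hl0, hl1⟩ => ?_
  set L : ℕ → Ω → ℝ := fun t ω => Real.exp (l * ∑ i ∈ Finset.Icc 1 t, (X i ω - m i ω) -
    psiE (b - a) l * ∑ i ∈ Finset.Icc 1 t, (X i ω - Xhat i ω) ^ 2)
  set R : ℕ → Ω → ℝ := fun t ω => Real.exp (l * (X (t + 1) ω - m (t + 1) ω) -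
    psiE (b - a) l * (X (t + 1) ω - Xhat (t + 1) ω) ^ 2)
  have hLm : StronglyAdapted F L := fun t =>
    (((hS t).const_mul l).sub ((hV t).const_mul _)).exp.stronglyMeasurable
  have hsucc : ∀ t, L (t + 1) = L t * R t := by
    intro t
    ext ω
    simp only [L, R, Pi.mul_apply, ← Real.exp_add, Finset.sum_Icc_succ_top t.succ_pos]
    ring_nf
  have hstep := fun t => condExp_exp_sub_psiE_le_one (F.le t) hab hl0 hl1 hXadp.measurable
    (hXbd (t + 1)) (hXhatpred t) (hXhatbd (t + 1)) (hmpred t) (hm t)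
  have hLbd : ∀ t : ℕ, ∀ᵐ ω ∂P, ‖L t ω‖ ≤ Real.exp (l * (b - a)) ^ t := by
    intro t
    induction t with
    | zero => simp [L]
    | succ t ih =>
      filter_upwards [ih, (hstep t).1] with ω h1 h2
      rw [hsucc, Pi.mul_apply, norm_mul, pow_succ]
      refine mul_le_mul h1 ?_ (norm_nonneg _) (by positivity)
      rwa [Real.norm_eq_abs, abs_of_pos (Real.exp_pos _)]
  have hRint : ∀ t, Integrable (R t) P := by
    intro t
    refine Integrable.of_bound ?_ (Real.exp (l * (b - a))) ?_
    · have h1 := (hmpred t).measurable.mono (F.le t) le_rfl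
      have h2 := (hXhatpred t).measurable.mono (F.le t) le_rfl
      have h3 : Measurable (X (t + 1)) := hXadp.measurable
      exact (((h3.sub h1).const_mul l).sub
        (((h3.sub h2).pow_const 2).const_mul _)).exp.aestronglyMeasurable
    · simpa [R, abs_of_pos (Real.exp_pos _)] using (hstep t).1
  refine supermartingale_nat hLm
    (fun t => Integrable.of_bound ((hLm t).mono (F.le t)).aestronglyMeasurable _ (hLbd t)) ?_
  intro t
  rw [hsucc]
  filter_upwards [condExp_stronglyMeasurable_mul_of_bound (F.le t) (hLm t) (hRint t) _ (hLbd t),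
    (hstep t).2] with ω h1 h2
  rw [h1, Pi.mul_apply]
  exact mul_le_of_le_one_right (Real.exp_pos _).le h2

/-- Theorem 4 (empirical-Bernstein confidence sequence): if `X_t ∈ [a,b]` a.s.,
`(X̂_t)` is any `[a,b]`-valued predictable sequence, and `u` is any sub-exponential
uniform boundary with crossing probability `α` for scale `c = b − a`, then
`P(∀ t ≥ 1 : |X̄_t − μ_t| < u(Σ_{i≤t}(X_i − X̂_i)²)/t) ≥ 1 − 2α`. -/
theorem empirical_bernstein_confidence_sequence
    {Ω : Type*} {mΩ : MeasurableSpace Ω} (P : Measure Ω) [IsProbabilityMeasure P]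
    (F : Filtration ℕ mΩ) (a b : ℝ) (hab : a < b)
    (X Xhat : ℕ → Ω → ℝ)
    (hXadp : Adapted F X) (hXint : ∀ t, Integrable (X t) P)
    (hXbd : ∀ t : ℕ, ∀ᵐ ω ∂P, X t ω ∈ Set.Icc a b)
    (hXhatbd : ∀ t : ℕ, ∀ᵐ ω ∂P, Xhat t ω ∈ Set.Icc a b)
    (hXhatpred : ∀ t : ℕ, StronglyMeasurable[F t] (Xhat (t + 1)))
    (α : ℝ) (hα : α ∈ Set.Ioo (0 : ℝ) 1)
    (u : ℝ → ℝ)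
    (hu : IsUniformBoundary {l : ℝ | 0 ≤ l ∧ l < 1 / (b - a)} (psiE (b - a)) 1 α u) :
    ENNReal.ofReal (1 - 2 * α) ≤
      P {ω | ∀ t : ℕ, 1 ≤ t →
        |(∑ i ∈ Finset.Icc 1 t, X i ω) / (t : ℝ)
            - (∑ i ∈ Finset.Icc 1 t, (P[X i|F (i - 1)]) ω) / (t : ℝ)|
          < u (∑ i ∈ Finset.Icc 1 t, (X i ω - Xhat i ω) ^ 2) / (t : ℝ)} := by
  set A : Set Ω := {ω | ∃ t : ℕ, 1 ≤ t ∧ u (∑ i ∈ Finset.Icc 1 t, (X i ω - Xhat i ω) ^ 2)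
    ≤ ∑ i ∈ Finset.Icc 1 t, (X i ω - (P[X i|F (i - 1)]) ω)}
  set B : Set Ω := {ω | ∃ t : ℕ, 1 ≤ t ∧
    u (∑ i ∈ Finset.Icc 1 t, ((-X) i ω - (-Xhat) i ω) ^ 2)
      ≤ ∑ i ∈ Finset.Icc 1 t, ((-X) i ω - -(P[X i|F (i - 1)]) ω)}
  have hA : P A ≤ ENNReal.ofReal α :=
    hu.measure_exists_le_sum_sub_condExp hab (m := fun i => P[X i|F (i - 1)]) hXadp hXbd hXhatbd
      hXhatpred (fun t => stronglyMeasurable_condExp) (fun t => EventuallyEq.rfl)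
  have hneg : -a - -b = b - a := by ring
  have hB : P B ≤ ENNReal.ofReal α :=
    IsUniformBoundary.measure_exists_le_sum_sub_condExp (neg_lt_neg hab)
      (m := fun i => -P[X i|F (i - 1)]) (fun t => (hXadp t).neg)
      (fun t => (hXbd t).mono fun ω h => ⟨neg_le_neg h.2, neg_le_neg h.1⟩)
      (fun t => (hXhatbd t).mono fun ω h => ⟨neg_le_neg h.2, neg_le_neg h.1⟩)
      (fun t => (hXhatpred t).neg) (fun t => stronglyMeasurable_condExp.neg)
      (fun t => (condExp_neg _ _).symm) (by rwa [hneg])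
  set C : Set Ω := {ω | ∀ t : ℕ, 1 ≤ t →
    |(∑ i ∈ Finset.Icc 1 t, X i ω) / (t : ℝ)
        - (∑ i ∈ Finset.Icc 1 t, (P[X i|F (i - 1)]) ω) / (t : ℝ)|
      < u (∑ i ∈ Finset.Icc 1 t, (X i ω - Xhat i ω) ^ 2) / (t : ℝ)}
  have hcover : (univ : Set Ω) ⊆ C ∪ (A ∪ B) := by
    intro ω _
    by_contra h
    simp only [mem_union, not_or] at h
    obtain ⟨hC, hA, hB⟩ := h
    refine hC fun t ht => ?_
    have ht' : (0 : ℝ) < t := by exact_mod_cast ht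
    rw [← sub_div, abs_div, abs_of_pos ht', div_lt_div_iff_of_pos_right ht', abs_lt]
    have h1 := not_le.1 fun h => hA ⟨t, ht, h⟩
    have h2 := not_le.1 fun h => hB ⟨t, ht, h⟩
    have h3 : ∀ i, ((-X) i ω - (-Xhat) i ω) ^ 2 = (X i ω - Xhat i ω) ^ 2 := fun i => by
      simp only [Pi.neg_apply]
      ring
    simp only [h3] at h2
    simp only [Pi.neg_apply, Finset.sum_sub_distrib, Finset.sum_neg_distrib] at h1 h2
    constructor <;> linarith
  have hone : 1 ≤ P C + (ENNReal.ofReal α + ENNReal.ofReal α) :=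
    calc (1 : ENNReal) = P univ := measure_univ.symm
      _ ≤ P (C ∪ (A ∪ B)) := measure_mono hcover
      _ ≤ P C + P (A ∪ B) := measure_union_le _ _
      _ ≤ P C + (ENNReal.ofReal α + ENNReal.ofReal α) := by
        gcongr
        exact (measure_union_le _ _).trans (add_le_add hA hB)
  rw [ENNReal.ofReal_sub _ (by linarith [hα.1]), ENNReal.ofReal_one, two_mul,
    ENNReal.ofReal_add hα.1.le hα.1.le]
  exact tsub_le_iff_right.2 hone
end
end
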